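/- Corollary (bounded form): Under the hypotheses of the previous corollary (z_{j+1} - z_j ≥ λ|I|, f ∈ C^{(r)}(I), m = (r+1)(μ+1), L the Hermite interpolant with derivatives up to order r matched at each z_ν), for all x ∈ I: |f(x) - L(x)| ≤ C(m,λ) · (dist(x,Z))^r · ω_{m-r}(f^{(r)}, |I|·(dist(x,Z)/|I|)^{1/(m-r)}; I) ≤ C(m,λ) · (dist(x,Z))^r · ω_{m-r}(f^{(r)}, |I|; I). -/

import Mathlib

open scoped BigOperators

open Classical in
/-- Divided difference with possibly repeated knots, via derivative data `F`
(`F j` is the `j`-th derivative). -/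
noncomputable def divDiff (F : ℕ → ℝ → ℝ) : List ℝ → ℝ
  | [] => 0
  | [x] => F 0 x
  | x :: y :: l =>
      if h : ∀ z ∈ y :: l, z = x then
        F ((y :: l).length) x / Nat.factorial ((y :: l).length)
      else
        (divDiff F (y :: l) -
          divDiff F (x :: (y :: l).eraseIdx ((y :: l).findIdx (fun z => z ≠ x)))) /
          ((y :: l).getD ((y :: l).findIdx (fun z => z ≠ x)) 0 - x)
termination_by l => l.length
decreasing_by
  · simp
  · push_neg at h
    obtain ⟨z, hz, hzx⟩ := h
    have hlt : (y :: l).findIdx (fun z => decide (z ≠ x)) < (y :: l).length :=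
      List.findIdx_lt_length_of_exists ⟨z, hz, by simpa using hzx⟩
    simp only [List.length_cons, List.length_eraseIdx] at *
    rw [if_pos hlt]; omega

/-- Newton form of the Hermite interpolation polynomial at the knots `xs`. -/
noncomputable def newtonSum (F : ℕ → ℝ → ℝ) (xs : List ℝ) (t : ℝ) : ℝ :=
  ∑ j ∈ Finset.range xs.length,
    divDiff F (xs.take (j + 1)) * ∏ i ∈ Finset.range j, (t - xs.getD i 0)

/-- The `k`-th symmetric difference of `g`, set to `0` when the relevant points
leave `[a,b]`. -/
noncomputable def kSymmDiff (k : ℕ) (g : ℝ → ℝ) (u x a b : ℝ) : ℝ :=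
  if a ≤ x - (k / 2 : ℝ) * u ∧ x + (k / 2 : ℝ) * u ≤ b then
    ∑ i ∈ Finset.range (k + 1), (-1 : ℝ) ^ i * (k.choose i) * g (x + ((k : ℝ) / 2 - i) * u)
  else 0

/-- The `k`-th modulus of smoothness of `g` on `[a,b]`. -/
noncomputable def smoothOmega (k : ℕ) (g : ℝ → ℝ) (t a b : ℝ) : ℝ :=
  sSup {v : ℝ | ∃ u x : ℝ, 0 < u ∧ u ≤ t ∧ v = |kSymmDiff k g u x a b|}

/-- First modulus of continuity of `g` on `[a,b]`. -/
noncomputable def omega1 (g : ℝ → ℝ) (t a b : ℝ) : ℝ :=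
  sSup {v : ℝ | ∃ x y : ℝ, x ∈ Set.Icc a b ∧ y ∈ Set.Icc a b ∧ |x - y| ≤ t ∧ v = |g x - g y|}

/-- Sup norm on `[a,b]`. -/
noncomputable def supNorm (g : ℝ → ℝ) (a b : ℝ) : ℝ :=
  sSup {v : ℝ | ∃ x ∈ Set.Icc a b, v = |g x|}

/-- The knots extended by `x₋₁ = x₀ - (xₘ - x₀)` and `x_{m+1} = xₘ + (xₘ - x₀)`. -/
noncomputable def xExt (m : ℕ) (x : ℕ → ℝ) : ℤ → ℝ := fun i =>
  if i < 0 then x 0 - (x m - x 0) else if (m : ℤ) < i then x m + (x m - x 0) else x i.toNat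

/-- `d(p,q) = min (x_{q+1} - x_p) (x_q - x_{p-1})`. -/
noncomputable def dpq (m : ℕ) (x : ℕ → ℝ) (p q : ℕ) : ℝ :=
  min (xExt m x ((q : ℤ) + 1) - x p) (x q - xExt m x ((p : ℤ) - 1))

/-- `Λ_{p,q,r}(x_0,…,x_m; φ)`. -/
noncomputable def Lam (m r : ℕ) (x : ℕ → ℝ) (φ : ℝ → ℝ) (p q : ℕ) : ℝ :=
  (∫ u in Set.Ioc (x q - x p) (dpq m x p q), u ^ ((p : ℤ) + r - q - 1) * φ u) /
    ((∏ i ∈ Finset.range p, (x q - x i)) * ∏ i ∈ Finset.Ioc q m, (x i - x p))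

/-- `Λ_r(x_0,…,x_m; φ) = max over admissible (p,q) of Λ_{p,q,r}`. -/
noncomputable def LamMax (m r : ℕ) (x : ℕ → ℝ) (φ : ℝ → ℝ) : ℝ :=
  sSup {v : ℝ | ∃ p q : ℕ, q ≤ m ∧ p + r + 1 ≤ q ∧ v = Lam m r x φ p q}

/-- A real polynomial has an antiderivative with a prescribed value at a given point. -/
theorem exists_poly_antideriv (Q : Polynomial ℝ) {n : ℕ} (hQ : Q.degree < n) (a v : ℝ) :
    ∃ P : Polynomial ℝ, P.derivative = Q ∧ P.degree < (n + 1 : ℕ) ∧ P.eval a = v := by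
  obtain ⟨R, hR, hRd⟩ : ∃ R : Polynomial ℝ, R.derivative = Q ∧ R.degree < (n + 1 : ℕ) := by
    refine ⟨∑ i ∈ Finset.range n, Polynomial.monomial (i + 1) (Q.coeff i / (i + 1)), ?_, ?_⟩
    · rw [Polynomial.derivative_sum]
      ext j
      simp only [Polynomial.derivative_monomial, Polynomial.finsetSum_coeff,
        Polynomial.coeff_monomial, Nat.add_sub_cancel, Finset.sum_ite_eq', Finset.mem_range]
      split_ifs with hj
      · push_cast
        field_simp
      · exact (Polynomial.coeff_eq_zero_of_degree_lt
          (hQ.trans_le (by exact_mod_cast not_lt.1 hj))).symm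
    · refine (Polynomial.degree_sum_le _ _).trans_lt ?_
      rw [Finset.sup_lt_iff (by exact WithBot.bot_lt_coe _)]
      intro i hi
      refine (Polynomial.degree_monomial_le _ _).trans_lt ?_
      have := Finset.mem_range.1 hi
      exact_mod_cast Nat.succ_lt_succ this
  refine ⟨R + Polynomial.C (v - R.eval a), by simp [hR], ?_, by simp⟩
  refine (Polynomial.degree_add_le _ _).trans_lt (max_lt hRd ?_)
  exact Polynomial.degree_C_le.trans_lt (by exact_mod_cast Nat.succ_pos n)

/-- The forward Steklov average of `ψ` with step `c`. -/
noncomputable def steklov (c : ℝ) (ψ : ℝ → ℝ) (x : ℝ) : ℝ :=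
  ∫ t in (0 : ℝ)..1, ψ (x + c * t)

theorem steklov_continuous {c : ℝ} {ψ : ℝ → ℝ} (hψ : Continuous ψ) :
    Continuous (steklov c ψ) := by
  apply intervalIntegral.continuous_parametric_intervalIntegral_of_continuous'
  simp only [Function.uncurry_def]
  fun_prop

theorem steklov_iterate_continuous {c : ℝ} {ψ : ℝ → ℝ} (hψ : Continuous ψ) (n : ℕ) :
    Continuous ((steklov c)^[n] ψ) := by
  induction n with
  | zero => exact hψ
  | succ n ih => rw [Function.iterate_succ_apply']; exact steklov_continuous ih

theorem fwdDiff_continuous {u : ℝ} {ψ : ℝ → ℝ} (hψ : Continuous ψ) :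
    Continuous (fwdDiff u ψ) := by
  unfold fwdDiff; fun_prop

theorem steklov_fwdDiff (c u : ℝ) {ψ : ℝ → ℝ} (hψ : Continuous ψ) :
    steklov c (fwdDiff u ψ) = fwdDiff u (steklov c ψ) := by
  funext x
  simp only [steklov, fwdDiff]
  rw [intervalIntegral.integral_sub (Continuous.intervalIntegrable (by fun_prop) _ _)
    (Continuous.intervalIntegrable (by fun_prop) _ _)]
  simp only [add_right_comm]

theorem steklov_iterate_fwdDiff (c u : ℝ) {ψ : ℝ → ℝ} (hψ : Continuous ψ) (n : ℕ) :
    (steklov c)^[n] (fwdDiff u ψ) = fwdDiff u ((steklov c)^[n] ψ) := by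
  induction n with
  | zero => rfl
  | succ n ih =>
    rw [Function.iterate_succ_apply', Function.iterate_succ_apply', ih,
      steklov_fwdDiff c u (steklov_iterate_continuous hψ n)]

theorem steklov_hasDerivAt {c : ℝ} (hc : c ≠ 0) {ψ : ℝ → ℝ} (hψ : Continuous ψ) (x : ℝ) :
    HasDerivAt (steklov c ψ) (c⁻¹ * fwdDiff c ψ x) x := by
  have h : ∀ y, HasDerivAt (fun y => ∫ t in (0 : ℝ)..y, ψ t) (ψ y) y := fun y =>
    intervalIntegral.integral_hasDerivAt_right (hψ.intervalIntegrable _ _)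
      hψ.aestronglyMeasurable.stronglyMeasurableAtFilter hψ.continuousAt
  have heq : steklov c ψ =
      fun y => c⁻¹ * ((∫ t in (0 : ℝ)..(y + c), ψ t) - ∫ t in (0 : ℝ)..y, ψ t) := by
    funext y
    rw [steklov, intervalIntegral.integral_comp_add_mul ψ hc,
      intervalIntegral.integral_interval_sub_left (hψ.intervalIntegrable _ _)
        (hψ.intervalIntegrable _ _)]
    simp
  rw [heq]
  exact (((h (x + c)).comp_add_const x c).sub (h x)).const_mul _

theorem steklov_iterate_comp_affine (c x : ℝ) (φ : ℝ → ℝ) (n : ℕ) :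
    (steklov 1)^[n] (fun τ => φ (x + c * τ)) = fun τ => (steklov c)^[n] φ (x + c * τ) := by
  induction n generalizing φ with
  | zero => rfl
  | succ n ih =>
    rw [Function.iterate_succ_apply, Function.iterate_succ_apply, ← ih]
    congr 1
    funext y
    simp only [steklov]
    congr 1
    funext t
    ring_nf

theorem steklov_iterate_sum {ι : Type*} (s : Finset ι) (w : ι → ℝ) (G : ι → ℝ → ℝ)
    (hG : ∀ i, Continuous (G i)) (c : ℝ) (n : ℕ) :
    (steklov c)^[n] (fun τ => ∑ i ∈ s, w i * G i τ) =
      fun τ => ∑ i ∈ s, w i * (steklov c)^[n] (G i) τ := by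
  induction n generalizing G with
  | zero => rfl
  | succ n ih =>
    simp only [Function.iterate_succ_apply]
    rw [← ih _ fun i => steklov_continuous (hG i)]
    congr 1
    funext y
    simp only [steklov]
    rw [intervalIntegral.integral_finsetSum fun i _ =>
      Continuous.intervalIntegrable (by have := hG i; fun_prop) _ _]
    simp only [intervalIntegral.integral_const_mul]

theorem steklov_one_iterate_abs_le {G : ℝ → ℝ} {W : ℝ} (n : ℕ) (y : ℝ)
    (hG : ∀ τ ∈ Set.Icc y (y + n), |G τ| ≤ W) : |(steklov 1)^[n] G y| ≤ W := by
  induction n generalizing y with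
  | zero => exact hG y (by simp)
  | succ n ih =>
    rw [Function.iterate_succ_apply', steklov]
    have := intervalIntegral.norm_integral_le_of_norm_le_const (a := (0 : ℝ)) (b := 1) (C := W)
      (f := fun t => (steklov 1)^[n] G (y + 1 * t)) (fun t ht => by
        rw [Set.uIoc_of_le zero_le_one] at ht
        refine ih _ fun τ hτ => hG τ ?_
        push_cast
        exact ⟨by linarith [hτ.1, ht.1], by linarith [hτ.2, ht.2]⟩)
    simpa using this

/-- The iterated Steklov average of `ψ` is close to a polynomial of degree `< n`, in Lipschitz
seminorm too, when the `n`-th difference of `ψ` is small. -/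
theorem exists_poly_near_steklov_iterate {c : ℝ} (hc : 0 < c) {H : ℝ} (hH0 : 0 ≤ H) (hH1 : H ≤ 1)
    {W : ℝ} (n : ℕ) {ψ : ℝ → ℝ} (hψ : Continuous ψ)
    (hW : ∀ x ∈ Set.Icc 0 H, |(fwdDiff c)^[n] ψ x| ≤ W) :
    ∃ P : Polynomial ℝ, P.degree < n ∧
      (∀ x ∈ Set.Icc 0 H, |(steklov c)^[n] ψ x - P.eval x| ≤ (c⁻¹) ^ n * W) ∧
      (n ≠ 0 → ∀ x ∈ Set.Icc 0 H, ∀ y ∈ Set.Icc 0 H,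
        |((steklov c)^[n] ψ y - P.eval y) - ((steklov c)^[n] ψ x - P.eval x)| ≤
          (c⁻¹) ^ n * W * |y - x|) := by
  induction n generalizing ψ with
  | zero => exact ⟨0, by simp, by simpa using hW, by simp⟩
  | succ n ih =>
    obtain ⟨Q, hQd, hQ, -⟩ := ih (fwdDiff_continuous (u := c) hψ) hW
    have hdeg : (Polynomial.C c⁻¹ * Q).degree < n :=
      (Polynomial.degree_C_mul (inv_ne_zero hc.ne')).trans_lt hQd
    obtain ⟨P, hPQ, hPd, hP0⟩ := exists_poly_antideriv _ hdeg 0 ((steklov c)^[n + 1] ψ 0)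
    have hlip : ∀ x ∈ Set.Icc 0 H, ∀ y ∈ Set.Icc 0 H,
        |((steklov c)^[n + 1] ψ y - P.eval y) - ((steklov c)^[n + 1] ψ x - P.eval x)| ≤
          (c⁻¹) ^ (n + 1) * W * |y - x| := by
      intro x hx y hy
      refine Convex.norm_image_sub_le_of_norm_hasDerivWithin_le
        (f := fun x => (steklov c)^[n + 1] ψ x - P.eval x)
        (f' := fun x => c⁻¹ * (fwdDiff c ((steklov c)^[n] ψ) x - Q.eval x)) (s := Set.Icc 0 H)
        (fun w _ => ?_) (fun w hw => ?_) (convex_Icc 0 H) hx hy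
      · have h1 := steklov_hasDerivAt hc.ne' (steklov_iterate_continuous (c := c) hψ n) w
        have h2 := P.hasDerivAt w
        rw [hPQ] at h2
        have := h1.sub h2
        rw [Polynomial.eval_mul, Polynomial.eval_C, ← mul_sub] at this
        rw [Function.iterate_succ_apply']
        exact this.hasDerivWithinAt
      · rw [← steklov_iterate_fwdDiff c c hψ, Real.norm_eq_abs, abs_mul,
          abs_of_pos (inv_pos.2 hc), pow_succ', mul_assoc]
        exact mul_le_mul_of_nonneg_left (hQ w hw) (inv_pos.2 hc).le
    refine ⟨P, hPd, fun x hx => ?_, fun _ => hlip⟩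
    have h0 : (0 : ℝ) ∈ Set.Icc 0 H := ⟨le_rfl, hH0⟩
    have := hlip 0 h0 x hx
    rw [hP0, sub_self, sub_zero, sub_zero] at this
    refine this.trans (mul_le_of_le_one_right ?_ ?_)
    · exact mul_nonneg (by positivity) ((abs_nonneg _).trans (hW 0 h0))
    · rw [abs_of_nonneg hx.1]; exact hx.2.trans hH1

theorem fwdDiff_zero_iterate {k : ℕ} (hk : 1 ≤ k) (φ : ℝ → ℝ) (x : ℝ) :
    (fwdDiff (0 : ℝ))^[k] φ x = 0 := by
  obtain ⟨n, rfl⟩ := Nat.exists_eq_add_of_le' hk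
  rw [Function.iterate_succ_apply']
  simp [fwdDiff]

theorem fwdDiff_iterate_eq_sum (k : ℕ) (u : ℝ) (φ : ℝ → ℝ) (x : ℝ) :
    (fwdDiff u)^[k] φ x =
      ∑ i ∈ Finset.range (k + 1), ((-1 : ℝ) ^ (k - i) * (k.choose i)) * φ (x + i * u) := by
  rw [fwdDiff_iter_eq_sum_shift]
  refine Finset.sum_congr rfl fun i _ => ?_
  simp [zsmul_eq_mul]

/-- Averaging the `k`-th differences of `φ` recovers `φ` up to Steklov averages. -/
theorem steklov_fwdDiff_average (k : ℕ) (s : ℝ) {φ : ℝ → ℝ} (hφ : Continuous φ) (x : ℝ) :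
    (steklov 1)^[k] (fun τ => (fwdDiff (s * τ))^[k] φ x) 0 =
      (-1 : ℝ) ^ k * φ x + ∑ j ∈ Finset.range k,
        ((-1 : ℝ) ^ (k - (j + 1)) * (k.choose (j + 1))) *
          (steklov (((j + 1 : ℕ) : ℝ) * s))^[k] φ x := by
  have h : (fun τ => (fwdDiff (s * τ))^[k] φ x) = fun τ => ∑ i ∈ Finset.range (k + 1),
      ((-1 : ℝ) ^ (k - i) * (k.choose i)) * φ (x + (i * s) * τ) := by
    funext τ
    rw [fwdDiff_iterate_eq_sum]
    simp only [mul_assoc]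
  rw [h, steklov_iterate_sum _ (fun i => (-1 : ℝ) ^ (k - i) * (k.choose i))
    (fun i τ => φ (x + (i * s) * τ)) (fun i => by fun_prop)]
  beta_reduce
  rw [Finset.sum_range_succ', add_comm]
  simp only [steklov_iterate_comp_affine]
  have h0 : ∀ n : ℕ, (steklov 0)^[n] φ = φ := fun n => by
    induction n with
    | zero => rfl
    | succ n ih => rw [Function.iterate_succ_apply', ih]; funext y; simp [steklov]
  simp [h0]

theorem sum_abs_choose_succ_le (k : ℕ) :
    ∑ j ∈ Finset.range k, |(-1 : ℝ) ^ (k - (j + 1)) * (k.choose (j + 1))| ≤ 2 ^ k := by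
  have h := Nat.sum_range_choose k
  rw [Finset.sum_range_succ'] at h
  have h' : ∑ j ∈ Finset.range k, k.choose (j + 1) ≤ 2 ^ k := by omega
  calc _ = ((∑ j ∈ Finset.range k, k.choose (j + 1) : ℕ) : ℝ) := by
        push_cast
        exact Finset.sum_congr rfl fun j _ => by simp [abs_mul]
    _ ≤ _ := by exact_mod_cast h'

theorem abs_sum_choose_succ_mul_le (k : ℕ) {F : ℕ → ℝ} {M : ℝ} (hM : 0 ≤ M)
    (hF : ∀ j < k, |F j| ≤ M) :
    |∑ j ∈ Finset.range k, ((-1 : ℝ) ^ (k - (j + 1)) * (k.choose (j + 1))) * F j| ≤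
      2 ^ k * M := by
  refine (Finset.abs_sum_le_sum_abs _ _).trans ?_
  calc _ ≤ ∑ j ∈ Finset.range k, |(-1 : ℝ) ^ (k - (j + 1)) * (k.choose (j + 1))| * M :=
        Finset.sum_le_sum fun j hj => by
          rw [abs_mul]
          exact mul_le_mul_of_nonneg_left (hF j (Finset.mem_range.1 hj)) (abs_nonneg _)
    _ ≤ _ := by
        rw [← Finset.sum_mul]
        exact mul_le_mul_of_nonneg_right (sum_abs_choose_succ_le k) hM

/-- A function on `[0, 1]` whose `k`-th differences with steps up to `σ` are at most `W` is close
on `[0, 2 / 3]` to a polynomial of degree `< k`. -/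
theorem exists_poly_near_left {k : ℕ} (hk : 1 ≤ k) :
    ∃ C : ℝ, 0 < C ∧ ∀ φ : ℝ → ℝ, Continuous φ → ∀ σ : ℝ, 0 < σ → σ ≤ 1 → ∀ W : ℝ,
      0 ≤ W → (∀ u x : ℝ, 0 < u → u ≤ σ → 0 ≤ x → x + k * u ≤ 1 → |(fwdDiff u)^[k] φ x| ≤ W) →
      ∃ P : Polynomial ℝ, P.degree < k ∧
        (∀ x ∈ Set.Icc (0 : ℝ) (2 / 3), |φ x - P.eval x| ≤ C * (W / σ ^ k)) ∧
        ∀ x ∈ Set.Icc (0 : ℝ) (2 / 3), ∀ y ∈ Set.Icc (0 : ℝ) (2 / 3),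
          |(φ y - P.eval y) - (φ x - P.eval x)| ≤ C * (W + W / σ ^ k * |y - x|) := by
  have hk' : (1 : ℝ) ≤ k := by exact_mod_cast hk
  refine ⟨2 + 2 ^ k * (3 * k ^ 2) ^ k, by positivity, fun φ hφ σ hσ0 hσ1 W hW0 hW => ?_⟩
  set s : ℝ := σ / (3 * k ^ 2) with hs
  have hs0 : 0 < s := by positivity
  have hsk : s * k ^ 2 = σ / 3 := by rw [hs]; field_simp
  have hsk' : k * s ≤ σ / 3 := by
    rw [← hsk]; nlinarith [mul_nonneg hs0.le (sub_nonneg.2 hk')]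
  have hsinv : s⁻¹ ^ k * W = (3 * k ^ 2) ^ k * (W / σ ^ k) := by
    rw [hs, inv_div, div_pow]; ring
  have hex : ∀ j : ℕ, ∃ P : Polynomial ℝ, j < k → P.degree < k ∧
      (∀ x ∈ Set.Icc (0 : ℝ) (2 / 3),
        |(steklov (((j + 1 : ℕ) : ℝ) * s))^[k] φ x - P.eval x| ≤ s⁻¹ ^ k * W) ∧
      ∀ x ∈ Set.Icc (0 : ℝ) (2 / 3), ∀ y ∈ Set.Icc (0 : ℝ) (2 / 3),
        |((steklov (((j + 1 : ℕ) : ℝ) * s))^[k] φ y - P.eval y) -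
          ((steklov (((j + 1 : ℕ) : ℝ) * s))^[k] φ x - P.eval x)| ≤
          s⁻¹ ^ k * W * |y - x| := by
    intro j
    by_cases hj : j < k
    swap
    · exact ⟨0, fun h => absurd h hj⟩
    have hj1 : (1 : ℝ) ≤ ((j + 1 : ℕ) : ℝ) := by push_cast; linarith [(Nat.cast_nonneg j : (0 : ℝ) ≤ j)]
    have hjk : ((j + 1 : ℕ) : ℝ) ≤ k := by exact_mod_cast hj
    set c : ℝ := ((j + 1 : ℕ) : ℝ) * s with hc
    have hc0 : 0 < c := by positivity
    have hcs : s ≤ c := by rw [hc]; nlinarith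
    have hck : c ≤ k * s := mul_le_mul_of_nonneg_right hjk hs0.le
    have hkc : k * c ≤ σ / 3 := by
      rw [← hsk]; nlinarith
    obtain ⟨P, hPd, hP1, hP2⟩ := exists_poly_near_steklov_iterate hc0
      (by norm_num : (0 : ℝ) ≤ 2 / 3) (by norm_num) (W := W) k hφ (fun x hx =>
        hW c x hc0 (by linarith) hx.1 (by linarith [hx.2]))
    have hle : c⁻¹ ^ k * W ≤ s⁻¹ ^ k * W := by gcongr
    refine ⟨P, fun _ => ⟨hPd, fun x hx => (hP1 x hx).trans hle, fun x hx y hy => ?_⟩⟩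
    exact (hP2 (by omega) x hx y hy).trans (mul_le_mul_of_nonneg_right hle (abs_nonneg _))
  choose p hp using hex
  set B : ℝ → ℝ := fun x => (steklov 1)^[k] (fun τ => (fwdDiff (s * τ))^[k] φ x) 0 with hB
  have hBW : ∀ x ∈ Set.Icc (0 : ℝ) (2 / 3), |B x| ≤ W := by
    intro x hx
    refine steklov_one_iterate_abs_le k 0 fun τ hτ => ?_
    rw [zero_add] at hτ
    rcases hτ.1.eq_or_lt with h | h
    · rw [← h, mul_zero, fwdDiff_zero_iterate hk, abs_zero]; exact hW0
    · have h1 : s * τ ≤ k * s := by rw [mul_comm]; exact mul_le_mul_of_nonneg_right hτ.2 hs0.le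
      have h2 : k * (s * τ) ≤ σ / 3 := by rw [← hsk]; nlinarith
      exact hW _ _ (by positivity) (by linarith) hx.1 (by linarith [hx.2])
  set w : ℕ → ℝ := fun j => (-1 : ℝ) ^ (k - (j + 1)) * (k.choose (j + 1)) with hw
  set T : ℕ → ℝ → ℝ := fun j x => (steklov (((j + 1 : ℕ) : ℝ) * s))^[k] φ x - (p j).eval x with hT
  set P : Polynomial ℝ :=
    Polynomial.C (-(-1 : ℝ) ^ k) * ∑ j ∈ Finset.range k, Polynomial.C (w j) * p j with hP
  have hsq : (-1 : ℝ) ^ k * (-1 : ℝ) ^ k = 1 := by rw [← mul_pow]; simp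
  have key : ∀ x, φ x - P.eval x = (-1 : ℝ) ^ k * (B x - ∑ j ∈ Finset.range k, w j * T j x) := by
    intro x
    have h := steklov_fwdDiff_average k s hφ x
    simp only [hB, h, hP, hT, hw, Polynomial.eval_mul, Polynomial.eval_C,
      Polynomial.eval_finsetSum, mul_sub, Finset.sum_sub_distrib]
    linear_combination (-φ x) * hsq
  have habs : ∀ v : ℝ, |(-1 : ℝ) ^ k * v| = |v| := fun v => by simp [abs_mul]
  have hσk : σ ^ k ≤ 1 := pow_le_one₀ hσ0.le hσ1
  have hWσ : W ≤ W / σ ^ k := by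
    rw [le_div_iff₀ (by positivity)]; exact mul_le_of_le_one_right hW0 hσk
  refine ⟨P, ?_, fun x hx => ?_, fun x hx y hy => ?_⟩
  · have hsum : (∑ j ∈ Finset.range k, Polynomial.C (w j) * p j).degree < k := by
      refine (Polynomial.degree_sum_le _ _).trans_lt ?_
      rw [Finset.sup_lt_iff (by exact WithBot.bot_lt_coe _)]
      intro j hj
      rw [← Polynomial.smul_eq_C_mul]
      exact (Polynomial.degree_smul_le _ _).trans_lt (hp j (Finset.mem_range.1 hj)).1
    rw [hP, ← Polynomial.smul_eq_C_mul]
    exact (Polynomial.degree_smul_le _ _).trans_lt hsum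
  · rw [key, habs]
    have h1 := abs_sum_choose_succ_mul_le k (F := fun j => T j x) (M := s⁻¹ ^ k * W)
      (by positivity) (fun j hj => (hp j hj).2.1 x hx)
    rw [hsinv] at h1
    have := (abs_sub _ _).trans (add_le_add (hBW x hx) h1)
    have h3 : 0 ≤ W / σ ^ k := by positivity
    calc _ ≤ _ := this
      _ ≤ _ := by linarith
  · rw [key, key, ← mul_sub, habs]
    have h1 := abs_sum_choose_succ_mul_le k (F := fun j => T j y - T j x)
      (M := s⁻¹ ^ k * W * |y - x|) (by positivity) (fun j hj => (hp j hj).2.2 x hx y hy)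
    rw [hsinv] at h1
    simp only [mul_sub, Finset.sum_sub_distrib] at h1
    have h2 := hBW x hx
    have h3 := hBW y hy
    have h4 : 0 ≤ W / σ ^ k * |y - x| := by positivity
    have h5 : 0 ≤ (2 : ℝ) ^ k * (3 * k ^ 2) ^ k * W := by positivity
    rw [abs_le] at *
    constructor <;> linarith

/-- A polynomial of degree `< (r + 1) * (μ + 1)` vanishing to order `r + 1` at `μ + 1` distinct
points is zero. -/
theorem poly_eq_zero_of_hermite_zero {r μ : ℕ} {z : Fin (μ + 1) → ℝ} (hz : Function.Injective z)
    {Q : Polynomial ℝ} (hQ : Q.degree < ((r + 1) * (μ + 1) : ℕ))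
    (h : ∀ i, ∀ j ≤ r, (Polynomial.derivative^[j] Q).eval (z i) = 0) : Q = 0 := by
  by_contra hne
  have hdvd : ∏ i, (Polynomial.X - Polynomial.C (z i)) ^ (r + 1) ∣ Q := by
    refine Finset.prod_dvd_of_coprime (fun i _ j _ hij => ?_) fun i _ => ?_
    · exact (Polynomial.pairwise_coprime_X_sub_C hz hij).pow
    · exact (Polynomial.le_rootMultiplicity_iff hne).1
        (Polynomial.lt_rootMultiplicity_of_isRoot_iterate_derivative hne (h i))
  have hdeg := Polynomial.degree_le_of_dvd hdvd hne
  rw [Polynomial.degree_prod] at hdeg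
  simp only [Polynomial.degree_pow, Polynomial.degree_X_sub_C, Finset.sum_const,
    Finset.card_univ, Fintype.card_fin] at hdeg
  refine absurd hQ (not_lt.2 (le_trans (le_of_eq ?_) hdeg))
  simp only [nsmul_eq_mul, mul_one]
  push_cast
  ring

/-- Quantitative uniqueness of Hermite interpolation on `[0, 1]`, uniformly over separated knots. -/
theorem exists_hermite_bound (r μ l : ℕ) {lam : ℝ} (hlam : 0 < lam) :
    ∃ C : ℝ, 0 < C ∧ ∀ z : Fin (μ + 1) → ℝ, (∀ i, z i ∈ Set.Icc (0 : ℝ) 1) →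
      (∀ i j, i ≠ j → lam ≤ |z i - z j|) →
      ∀ Q : Polynomial ℝ, Q.degree < ((r + 1) * (μ + 1) : ℕ) → ∀ ε : ℝ, 0 ≤ ε →
      (∀ i, ∀ j ≤ r, |(Polynomial.derivative^[j] Q).eval (z i)| ≤ ε) →
      ∀ x ∈ Set.Icc (0 : ℝ) 1, |(Polynomial.derivative^[l] Q).eval x| ≤ C * ε := by
  set m := (r + 1) * (μ + 1) with hm
  let q : (Fin m → ℝ) → Polynomial ℝ := fun c => ∑ i, c i • (Polynomial.X : Polynomial ℝ) ^ (i : ℕ)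
  have hq : ∀ c j x, (Polynomial.derivative^[j] (q c)).eval x =
      ∑ i, c i * (Polynomial.derivative^[j] ((Polynomial.X : Polynomial ℝ) ^ (i : ℕ))).eval x := by
    intro c j x
    simp only [q, Polynomial.iterate_derivative_sum, Polynomial.iterate_derivative_smul,
      Polynomial.eval_finsetSum, Polynomial.eval_smul, smul_eq_mul]
  have hqd : ∀ c, (q c).degree < m := by
    intro c
    refine (Polynomial.degree_sum_le _ _).trans_lt ?_
    rw [Finset.sup_lt_iff (by exact WithBot.bot_lt_coe _)]
    intro i _
    refine (Polynomial.degree_smul_le _ _).trans_lt ?_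
    rw [Polynomial.degree_X_pow]
    exact_mod_cast i.2
  have hqs : ∀ Q : Polynomial ℝ, Q.degree < m → q (fun i => Q.coeff i) = Q := by
    intro Q hQ
    ext n
    simp only [q, Polynomial.finsetSum_coeff, Polynomial.coeff_smul, Polynomial.coeff_X_pow,
      smul_eq_mul, mul_ite, mul_one, mul_zero]
    rw [Fin.sum_univ_eq_sum_range (fun i => if n = i then Q.coeff i else 0), Finset.sum_ite_eq]
    split_ifs with h
    · rfl
    · exact (Polynomial.coeff_eq_zero_of_degree_lt
        (hQ.trans_le (by exact_mod_cast not_lt.1 (by simpa using h)))).symm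
  let F : (Fin (μ + 1) → ℝ) × (Fin m → ℝ) → ℝ := fun p =>
    ∑ i, ∑ j ∈ Finset.range (r + 1), |(Polynomial.derivative^[j] (q p.2)).eval (p.1 i)|
  have hF : Continuous F := by
    simp only [F, hq]
    fun_prop
  let K : Set (Fin (μ + 1) → ℝ) :=
    Set.univ.pi (fun _ => Set.Icc (0 : ℝ) 1) ∩ {z | ∀ i j, i ≠ j → lam ≤ |z i - z j|}
  have hK : IsCompact K := by
    refine (isCompact_univ_pi fun _ => isCompact_Icc).inter_right ?_
    simp only [Set.ofPred_forall]
    refine isClosed_iInter fun i => isClosed_iInter fun j => isClosed_iInter fun _ => ?_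
    exact isClosed_le continuous_const (by fun_prop)
  obtain ⟨δ, hδ, hδF⟩ := (hK.prod (isCompact_sphere (0 : Fin m → ℝ) 1)).exists_forall_le'
    hF.continuousOn (a := 0) (by
      rintro ⟨z, c⟩ ⟨hz, hc⟩
      refine lt_of_le_of_ne (by positivity) fun h0 => ?_
      have h0' : F (z, c) = 0 := h0.symm
      have hc0 : q c = 0 := by
        refine poly_eq_zero_of_hermite_zero (r := r) (z := z) ?_ (hqd c) ?_
        · intro i j hij
          by_contra hne
          have := hz.2 i j hne
          simp only [hij, sub_self, abs_zero] at this
          linarith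
        · intro i j hj
          have h1 := (Finset.sum_eq_zero_iff_of_nonneg
            (fun i _ => by positivity)).1 h0' i (Finset.mem_univ i)
          have h2 := (Finset.sum_eq_zero_iff_of_nonneg
            (fun j _ => by positivity)).1 h1 j (Finset.mem_range.2 (by omega))
          exact abs_eq_zero.1 h2
      have hc1 : c = 0 := by
        funext i
        have : (q c).coeff i = 0 := by rw [hc0]; simp
        simpa [q, Polynomial.finsetSum_coeff, Polynomial.coeff_X_pow, Fin.val_inj] using this
      rw [hc1] at hc
      simp at hc)
  have hcoef : ∀ z ∈ K, ∀ c, δ * ‖c‖ ≤ F (z, c) := by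
    intro z hz c
    by_cases hc : c = 0
    · rw [hc, norm_zero, mul_zero]; positivity
    have hn : 0 < ‖c‖ := norm_pos_iff.2 hc
    have h1 := hδF (z, ‖c‖⁻¹ • c) ⟨hz, by simp [norm_smul, hn.ne']⟩
    have h2 : F (z, ‖c‖⁻¹ • c) = ‖c‖⁻¹ * F (z, c) := by
      simp only [F, hq, Finset.mul_sum]
      refine Finset.sum_congr rfl fun i _ => Finset.sum_congr rfl fun j _ => ?_
      rw [← abs_of_pos (inv_pos.2 hn), ← abs_mul, Finset.mul_sum, abs_of_pos (inv_pos.2 hn)]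
      simp [mul_assoc]
    rw [h2, inv_mul_eq_div, le_div_iff₀ hn] at h1
    exact h1
  set E : ℝ := ∑ i : Fin m, ((i : ℕ).descFactorial l : ℝ) with hE
  have hE0 : 0 ≤ E := by positivity
  refine ⟨m / δ * E + 1, by positivity, fun z hz hsep Q hQ ε hε hQε x hx => ?_⟩
  set c : Fin m → ℝ := fun i => Q.coeff i with hc
  have hQc : q c = Q := hqs Q hQ
  have h1 := hcoef z ⟨fun i _ => hz i, hsep⟩ c
  have h2 : F (z, c) ≤ m * ε := by
    simp only [F, hQc]
    calc _ ≤ ∑ i : Fin (μ + 1), ∑ j ∈ Finset.range (r + 1), ε :=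
          Finset.sum_le_sum fun i _ => Finset.sum_le_sum fun j hj =>
            hQε i j (Nat.lt_succ_iff.1 (Finset.mem_range.1 hj))
      _ = _ := by simp [hm]; ring
  have h3 : ‖c‖ ≤ m / δ * ε := by
    rw [div_mul_eq_mul_div, le_div_iff₀ hδ]; linarith
  have h4 : |(Polynomial.derivative^[l] Q).eval x| ≤ ‖c‖ * E := by
    rw [← hQc, hq, hE, Finset.mul_sum]
    refine (Finset.abs_sum_le_sum_abs _ _).trans (Finset.sum_le_sum fun i _ => ?_)
    rw [abs_mul]
    refine mul_le_mul (norm_le_pi_norm c i) ?_ (abs_nonneg _) (norm_nonneg _)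
    rw [Polynomial.iterate_derivative_X_pow_eq_natCast_mul, Polynomial.eval_mul,
      Polynomial.eval_natCast, Polynomial.eval_pow, Polynomial.eval_X, abs_mul, Nat.abs_cast,
      abs_of_nonneg (pow_nonneg hx.1 _)]
    exact mul_le_of_le_one_right (Nat.cast_nonneg _) (pow_le_one₀ hx.1 hx.2)
  calc _ ≤ ‖c‖ * E := h4
    _ ≤ m / δ * ε * E := mul_le_mul_of_nonneg_right h3 hE0
    _ ≤ _ := by nlinarith

/-- Iterated mean value inequality for a chain of derivatives vanishing at a point. -/
theorem abs_le_of_vanishing_derivs {S : Set ℝ} (hS : Convex ℝ S) {G : ℕ → ℝ → ℝ} {r : ℕ}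
    (hG : ∀ j < r, ∀ x ∈ S, HasDerivWithinAt (G j) (G (j + 1) x) S x) {a : ℝ} (ha : a ∈ S)
    (hGa : ∀ j < r, G j a = 0) {M d : ℝ} (hM : ∀ x ∈ S, |G r x| ≤ M)
    (hd : ∀ x ∈ S, |x - a| ≤ d) {j : ℕ} (hj : j ≤ r) : ∀ x ∈ S, |G j x| ≤ M * d ^ (r - j) := by
  have hM0 : 0 ≤ M := (abs_nonneg _).trans (hM a ha)
  have hd0 : 0 ≤ d := (abs_nonneg _).trans (hd a ha)
  induction hj using Nat.decreasingInduction with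
  | self => simpa using hM
  | of_succ j hj ih =>
    intro x hx
    have h := Convex.norm_image_sub_le_of_norm_hasDerivWithin_le (hG j hj) ih hS ha hx
    rw [hGa j hj, sub_zero] at h
    refine h.trans ?_
    rw [show r - j = r - (j + 1) + 1 by omega, pow_succ, ← mul_assoc]
    exact mul_le_mul_of_nonneg_left (hd x hx) (by positivity)

theorem exists_poly_iterated_antideriv {n : ℕ} {P : Polynomial ℝ} (hP : P.degree < n) (a : ℝ)
    (r : ℕ) : ∃ Q : Polynomial ℝ, Q.degree < (n + r : ℕ) ∧ Polynomial.derivative^[r] Q = P ∧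
      ∀ j < r, (Polynomial.derivative^[j] Q).eval a = 0 := by
  induction r with
  | zero => exact ⟨P, hP, rfl, by simp⟩
  | succ r ih =>
    obtain ⟨Q, hQd, hQP, hQ⟩ := ih
    obtain ⟨R, hRQ, hRd, hR⟩ := exists_poly_antideriv Q hQd a 0
    refine ⟨R, hRd, by rw [Function.iterate_succ_apply, hRQ, hQP], fun j hj => ?_⟩
    cases j with
    | zero => exact hR
    | succ j => rw [Function.iterate_succ_apply, hRQ]; exact hQ j (by omega)

theorem fwdDiff_iterate_reflect (k : ℕ) (u : ℝ) (φ : ℝ → ℝ) (x : ℝ) :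
    |(fwdDiff u)^[k] (fun y => φ (1 - y)) x| = |(fwdDiff u)^[k] φ (1 - x - k * u)| := by
  have key : (fwdDiff u)^[k] (fun y => φ (1 - y)) x =
      (-1 : ℝ) ^ k * (fwdDiff u)^[k] φ (1 - x - k * u) := by
    rw [fwdDiff_iterate_eq_sum, fwdDiff_iterate_eq_sum, ← Finset.sum_range_reflect,
      Finset.mul_sum]
    refine Finset.sum_congr rfl fun i hi => ?_
    obtain ⟨l, rfl⟩ := Nat.exists_eq_add_of_le (Nat.lt_succ_iff.1 (Finset.mem_range.1 hi))
    have h1 : i + l + 1 - 1 - i = l := by omega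
    have hsq : (-1 : ℝ) ^ l * (-1 : ℝ) ^ l = 1 := by rw [← mul_pow]; simp
    rw [h1, Nat.add_sub_cancel, Nat.add_sub_cancel_left, Nat.choose_symm_add,
      show 1 - x - ((i + l : ℕ) : ℝ) * u + i * u = 1 - (x + l * u) by push_cast; ring, pow_add]
    linear_combination (-((-1 : ℝ) ^ i * ((i + l).choose l) * φ (1 - (x + l * u)))) * hsq
  rw [key]
  simp [abs_mul]

theorem exists_poly_near_right {k : ℕ} (hk : 1 ≤ k) :
    ∃ C : ℝ, 0 < C ∧ ∀ φ : ℝ → ℝ, Continuous φ → ∀ σ : ℝ, 0 < σ → σ ≤ 1 → ∀ W : ℝ,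
      0 ≤ W → (∀ u x : ℝ, 0 < u → u ≤ σ → 0 ≤ x → x + k * u ≤ 1 → |(fwdDiff u)^[k] φ x| ≤ W) →
      ∃ P : Polynomial ℝ, P.degree < k ∧
        (∀ x ∈ Set.Icc (1 / 3 : ℝ) 1, |φ x - P.eval x| ≤ C * (W / σ ^ k)) ∧
        ∀ x ∈ Set.Icc (1 / 3 : ℝ) 1, ∀ y ∈ Set.Icc (1 / 3 : ℝ) 1,
          |(φ y - P.eval y) - (φ x - P.eval x)| ≤ C * (W + W / σ ^ k * |y - x|) := by
  obtain ⟨C, hC, h⟩ := exists_poly_near_left hk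
  refine ⟨C, hC, fun φ hφ σ hσ0 hσ1 W hW0 hW => ?_⟩
  obtain ⟨P, hPd, hP1, hP2⟩ := h (fun y => φ (1 - y)) (by fun_prop) σ hσ0 hσ1 W hW0
    (fun u x hu hus hx hxu => by
      rw [fwdDiff_iterate_reflect]
      exact hW u _ hu hus (by linarith) (by linarith))
  have hmem : ∀ x ∈ Set.Icc (1 / 3 : ℝ) 1, 1 - x ∈ Set.Icc (0 : ℝ) (2 / 3) := fun x hx =>
    ⟨by linarith [hx.2], by linarith [hx.1]⟩
  refine ⟨P.comp (1 - Polynomial.X), ?_, fun x hx => ?_, fun x hx y hy => ?_⟩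
  · by_cases hP : P = 0
    · simp [hP]
    refine Polynomial.degree_le_natDegree.trans_lt ?_
    have h1 := (Polynomial.natDegree_lt_iff_degree_lt hP).2 hPd
    have h2 : (1 - Polynomial.X : Polynomial ℝ).natDegree ≤ 1 := by compute_degree
    have h3 := Polynomial.natDegree_comp_le (p := P) (q := (1 - Polynomial.X : Polynomial ℝ))
    have h4 := Nat.mul_le_mul_left P.natDegree h2
    exact_mod_cast (by omega : (P.comp (1 - Polynomial.X)).natDegree < k)
  · simpa using hP1 _ (hmem x hx)
  · have := hP2 _ (hmem x hx) _ (hmem y hy)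
    simpa [abs_sub_comm] using this

/-- Two-sided local version of Whitney's inequality on `[0, 1]`: `P` and `R` are both globally
close to `φ`, and each is close in Lipschitz seminorm on its own part of the interval. -/
theorem exists_poly_near {k : ℕ} (hk : 1 ≤ k) :
    ∃ C : ℝ, 0 < C ∧ ∀ φ : ℝ → ℝ, Continuous φ → ∀ σ : ℝ, 0 < σ → σ ≤ 1 → ∀ W : ℝ,
      0 ≤ W → (∀ u x : ℝ, 0 < u → u ≤ σ → 0 ≤ x → x + k * u ≤ 1 → |(fwdDiff u)^[k] φ x| ≤ W) →
      ∃ P R : Polynomial ℝ, P.degree < k ∧ R.degree < k ∧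
        (∀ x ∈ Set.Icc (0 : ℝ) 1, |φ x - P.eval x| ≤ C * (W / σ ^ k)) ∧
        (∀ x ∈ Set.Icc (0 : ℝ) 1, |φ x - R.eval x| ≤ C * (W / σ ^ k)) ∧
        (∀ x ∈ Set.Icc (0 : ℝ) (2 / 3), ∀ y ∈ Set.Icc (0 : ℝ) (2 / 3),
          |(φ y - P.eval y) - (φ x - P.eval x)| ≤ C * (W + W / σ ^ k * |y - x|)) ∧
        ∀ x ∈ Set.Icc (1 / 3 : ℝ) 1, ∀ y ∈ Set.Icc (1 / 3 : ℝ) 1,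
          |(φ y - R.eval y) - (φ x - R.eval x)| ≤ C * (W + W / σ ^ k * |y - x|) := by
  obtain ⟨A, hA, hleft⟩ := exists_poly_near_left hk
  obtain ⟨B, hB, hright⟩ := exists_poly_near_right hk
  have hk0 : (0 : ℝ) < k := by exact_mod_cast hk
  obtain ⟨D, hD, hext⟩ := exists_hermite_bound 0 (k - 1) 0
    (lam := 1 / (3 * k)) (by positivity)
  refine ⟨(A + B) * (1 + D), by positivity, fun φ hφ σ hσ0 hσ1 W hW0 hW => ?_⟩
  obtain ⟨P, hPd, hP1, hP2⟩ := hleft φ hφ σ hσ0 hσ1 W hW0 hW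
  obtain ⟨R, hRd, hR1, hR2⟩ := hright φ hφ σ hσ0 hσ1 W hW0 hW
  set ε := W / σ ^ k with hε
  have hε0 : 0 ≤ ε := by positivity
  have hfin : ∀ i : Fin (k - 1 + 1), ((i : ℕ) : ℝ) / (3 * k) ≤ 1 / 3 := fun i => by
    have : ((i : ℕ) : ℝ) ≤ k := by exact_mod_cast (by omega : (i : ℕ) ≤ k)
    rw [div_le_iff₀ (by positivity)]; linarith
  have hPR := hext (fun i => 1 / 3 + (i : ℕ) / (3 * k))
    (fun i => ⟨by positivity, by linarith [hfin i]⟩)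
    (fun i j hij => by
      rw [add_sub_add_left_eq_sub, ← sub_div, abs_div, abs_of_pos (by positivity : (0 : ℝ) < 3 * k)]
      gcongr
      have : (1 : ℤ) ≤ |((i : ℕ) : ℤ) - ((j : ℕ) : ℤ)| :=
        Int.one_le_abs (by have := Fin.val_ne_of_ne hij; omega)
      exact_mod_cast this)
    (P - R) (by
      refine (Polynomial.degree_sub_le _ _).trans_lt (max_lt ?_ ?_) <;>
      simp [Nat.sub_add_cancel hk, *])
    ((A + B) * ε) (by positivity) (fun i j hj => by
      obtain rfl : j = 0 := by omega
      have h1 := hP1 (1 / 3 + (i : ℕ) / (3 * k)) ⟨by positivity, by linarith [hfin i]⟩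
      have h2 := hR1 (1 / 3 + (i : ℕ) / (3 * k))
        ⟨le_add_of_nonneg_right (by positivity), by linarith [hfin i]⟩
      simp only [Function.iterate_zero, id, Polynomial.eval_sub]
      rw [abs_le] at *
      constructor <;> linarith)
  simp only [Function.iterate_zero, id, Polynomial.eval_sub] at hPR
  have hAle : A ≤ (A + B) * (1 + D) := by nlinarith [mul_pos (add_pos hA hB) hD]
  have hBle : B ≤ (A + B) * (1 + D) := by nlinarith [mul_pos (add_pos hA hB) hD]
  have hADε : A * ε + D * ((A + B) * ε) ≤ (A + B) * (1 + D) * ε := by nlinarith [mul_nonneg hB.le hε0]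
  have hBDε : B * ε + D * ((A + B) * ε) ≤ (A + B) * (1 + D) * ε := by nlinarith [mul_nonneg hA.le hε0]
  have hDε : 0 ≤ D * ((A + B) * ε) := by positivity
  refine ⟨P, R, hPd, hRd, fun x hx => ?_, fun x hx => ?_, fun x hx y hy => ?_, fun x hx y hy => ?_⟩
  · have h := hPR x hx
    rcases le_total x (2 / 3) with h' | h'
    · have h1 := hP1 x ⟨hx.1, h'⟩
      rw [abs_le] at *
      constructor <;> linarith
    · have h1 := hR1 x ⟨by linarith, hx.2⟩
      rw [abs_le] at *
      constructor <;> linarith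
  · have h := hPR x hx
    rcases le_total x (2 / 3) with h' | h'
    · have h1 := hP1 x ⟨hx.1, h'⟩
      rw [abs_le] at *
      constructor <;> linarith
    · have h1 := hR1 x ⟨by linarith, hx.2⟩
      rw [abs_le] at *
      constructor <;> linarith
  · exact (hP2 x hx y hy).trans (mul_le_mul_of_nonneg_right hAle (by positivity))
  · exact (hR2 x hx y hy).trans (mul_le_mul_of_nonneg_right hBle (by positivity))

/-- Pointwise bound on `[0, 1]` for a function vanishing to order `r + 1` at separated knots. -/
theorem exists_vanishing_bound (r μ : ℕ) {lam : ℝ} (hlam : 0 < lam) :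
    ∃ C : ℝ, 0 < C ∧ ∀ z : Fin (μ + 1) → ℝ, (∀ i, z i ∈ Set.Icc (0 : ℝ) 1) →
      (∀ i j, i ≠ j → lam ≤ |z i - z j|) → ∀ G : ℕ → ℝ → ℝ,
      (∀ j < r, ∀ x ∈ Set.Icc (0 : ℝ) 1,
        HasDerivWithinAt (G j) (G (j + 1) x) (Set.Icc 0 1) x) →
      ContinuousOn (G r) (Set.Icc 0 1) → (∀ i, ∀ j ≤ r, G j (z i) = 0) →
      ∀ σ : ℝ, 0 < σ → σ ≤ 1 → ∀ W : ℝ, 0 ≤ W →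
      (∀ u x : ℝ, 0 < u → u ≤ σ → 0 ≤ x → x + ((r + 1) * μ + 1 : ℕ) * u ≤ 1 →
        |(fwdDiff u)^[(r + 1) * μ + 1] (G r) x| ≤ W) →
      ∀ i, ∀ t ∈ Set.Icc (0 : ℝ) 1, |t - z i| ≤ σ ^ ((r + 1) * μ + 1) →
        |G 0 t| ≤ C * (σ ^ ((r + 1) * μ + 1)) ^ r * W := by
  obtain ⟨A, hA, hpoly⟩ := exists_poly_near (k := (r + 1) * μ + 1) (by omega)
  obtain ⟨B, hB, hval⟩ := exists_hermite_bound r μ r hlam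
  obtain ⟨D, hD, hder⟩ := exists_hermite_bound r μ (r + 1) hlam
  refine ⟨2 * A + D * A + 3 * (A + B * A), by positivity,
    fun z hz hsep G hG hGc hGz σ hσ0 hσ1 W hW0 hW i t ht htz => ?_⟩
  set k := (r + 1) * μ + 1 with hk
  set φ : ℝ → ℝ := Set.IccExtend (zero_le_one' ℝ) ((Set.Icc (0 : ℝ) 1).domRestrict (G r)) with hφ
  have hφc : Continuous φ := (continuousOn_iff_continuous_domRestrict.1 hGc).Icc_extend'
  have hφG : ∀ x ∈ Set.Icc (0 : ℝ) 1, φ x = G r x := fun x hx => by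
    rw [hφ, Set.IccExtend_of_mem _ _ hx]; rfl
  obtain ⟨P, R, hPd, hRd, hP1, hR1, hP2, hR2⟩ := hpoly φ hφc σ hσ0 hσ1 W hW0
    (fun u x hu hus hx hxu => by
      refine le_of_eq_of_le ?_ (hW u x hu hus hx hxu)
      rw [fwdDiff_iterate_eq_sum, fwdDiff_iterate_eq_sum]
      congr 1
      refine Finset.sum_congr rfl fun i hi => ?_
      have hik : (i : ℝ) ≤ k := by exact_mod_cast Nat.lt_succ_iff.1 (Finset.mem_range.1 hi)
      rw [hφG _ ⟨by positivity, by nlinarith⟩])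
  set ε := W / σ ^ k with hε
  have hσk : 0 < σ ^ k := by positivity
  have hε0 : 0 ≤ ε := by positivity
  have hbound : ∀ S : Polynomial ℝ, S.degree < k →
      (∀ x ∈ Set.Icc (0 : ℝ) 1, |φ x - S.eval x| ≤ A * ε) → ∀ x ∈ Set.Icc (0 : ℝ) 1,
      |S.eval x| ≤ B * (A * ε) ∧ |S.derivative.eval x| ≤ D * (A * ε) := by
    intro S hSd hS x hx
    obtain ⟨Q, hQd, hQS, hQ⟩ := exists_poly_iterated_antideriv hSd (z 0) r
    have hQd' : Q.degree < ((r + 1) * (μ + 1) : ℕ) := by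
      rwa [show (r + 1) * (μ + 1) = k + r by rw [hk]; ring]
    have hQε : ∀ i, ∀ j ≤ r, |(Polynomial.derivative^[j] Q).eval (z i)| ≤ A * ε := by
      intro i j hj
      have := abs_le_of_vanishing_derivs (convex_Icc (0 : ℝ) 1)
        (G := fun j x => G j x - (Polynomial.derivative^[j] Q).eval x) (r := r)
        (fun j hj x hx => (hG j hj x hx).sub (by
          rw [Function.iterate_succ_apply']
          exact (Polynomial.hasDerivAt _ x).hasDerivWithinAt))
        (hz 0) (fun j hj => by rw [hGz 0 j hj.le, hQ j hj, sub_zero]) (M := A * ε) (d := 1)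
        (fun x hx => by rw [hQS, ← hφG x hx]; exact hS x hx)
        (fun x hx => abs_le.2 ⟨by linarith [hx.1, (hz 0).2], by linarith [hx.2, (hz 0).1]⟩) hj
        (z i) (hz i)
      simpa [hGz i j hj] using this
    have h1 := hval z hz hsep Q hQd' _ (by positivity) hQε x hx
    have h2 := hder z hz hsep Q hQd' _ (by positivity) hQε x hx
    rw [Function.iterate_succ_apply', hQS] at h2
    rw [hQS] at h1
    exact ⟨h1, h2⟩
  have hlip : ∀ S : Polynomial ℝ, S.degree < k →
      (∀ x ∈ Set.Icc (0 : ℝ) 1, |φ x - S.eval x| ≤ A * ε) → ∀ u ∈ Set.Icc (0 : ℝ) 1,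
      |u - z i| ≤ σ ^ k →
      |(φ u - S.eval u) - (φ (z i) - S.eval (z i))| ≤ A * (W + ε * |u - z i|) →
      |φ u| ≤ (2 * A + D * A) * W := by
    intro S hSd hS u hu huz h
    have h1 := Convex.norm_image_sub_le_of_norm_hasDerivWithin_le
      (fun x _ => (S.hasDerivAt x).hasDerivWithinAt) (fun x hx => (hbound S hSd hS x hx).2)
      (convex_Icc (0 : ℝ) 1) (hz i) hu
    rw [Real.norm_eq_abs, Real.norm_eq_abs] at h1
    have h2 : ε * |u - z i| ≤ W := by
      rw [hε, div_mul_eq_mul_div, div_le_iff₀ hσk]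
      exact mul_le_mul_of_nonneg_left huz hW0
    have h3 : φ (z i) = 0 := by rw [hφG _ (hz i), hGz i r le_rfl]
    rw [h3] at h
    have h4 : A * (W + ε * |u - z i|) ≤ 2 * A * W := by nlinarith
    have h5 : D * (A * ε) * |u - z i| ≤ D * A * W := by nlinarith [mul_pos hD hA]
    rw [abs_le] at *
    constructor <;> linarith
  have hGr : ∀ u ∈ Set.Icc (0 : ℝ) 1, |u - z i| ≤ σ ^ k →
      |G r u| ≤ (2 * A + D * A + 3 * (A + B * A)) * W := by
    intro u hu huz
    rw [← hφG u hu]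
    have hpos1 : 0 ≤ 3 * (A + B * A) * W := by positivity
    have hpos2 : 0 ≤ (2 * A + D * A) * W := by positivity
    by_cases hl : u ≤ 2 / 3 ∧ z i ≤ 2 / 3
    · have := hlip P hPd hP1 u hu huz (hP2 _ ⟨(hz i).1, hl.2⟩ _ ⟨hu.1, hl.1⟩)
      linarith
    by_cases hr : 1 / 3 ≤ u ∧ 1 / 3 ≤ z i
    · have := hlip R hRd hR1 u hu huz (hR2 _ ⟨hr.2, (hz i).2⟩ _ ⟨hr.1, hu.2⟩)
      linarith
    have hfar : 1 / 3 ≤ |u - z i| := by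
      rw [le_abs]
      rcases not_and_or.1 hl with h | h <;> rcases not_and_or.1 hr with h' | h' <;>
        first
        | (left; linarith)
        | (right; linarith)
    have hε3 : ε ≤ 3 * W := by
      rw [hε, div_le_iff₀ hσk]; nlinarith
    have h1 := hP1 u hu
    have h2 := (hbound P hPd hP1 u hu).1
    have h3 : A * ε ≤ A * (3 * W) := mul_le_mul_of_nonneg_left hε3 hA.le
    have h4 : B * (A * ε) ≤ B * (A * (3 * W)) := mul_le_mul_of_nonneg_left h3 hB.le
    rw [abs_le] at *
    constructor <;> linarith
  have hsub : Set.uIcc (z i) t ⊆ Set.Icc 0 1 := Set.uIcc_subset_Icc (hz i) ht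
  have hdist : ∀ x ∈ Set.uIcc (z i) t, |x - z i| ≤ σ ^ k := fun x hx =>
    (Set.abs_sub_left_of_mem_uIcc hx).trans htz
  have := abs_le_of_vanishing_derivs (convex_uIcc (z i) t) (G := G) (r := r)
    (fun j hj x hx => (hG j hj x (hsub hx)).mono hsub) Set.left_mem_uIcc
    (fun j hj => hGz i j hj.le) (fun x hx => hGr x (hsub hx) (hdist x hx)) hdist
    (Nat.zero_le r) t Set.right_mem_uIcc
  refine this.trans (le_of_eq ?_)
  rw [Nat.sub_zero]
  ring

theorem kSymmDiff_eq_fwdDiff {k : ℕ} {g : ℝ → ℝ} {u y a b : ℝ} (ha : a ≤ y)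
    (hb : y + k * u ≤ b) :
    kSymmDiff k g u (y + (k / 2 : ℝ) * u) a b = (fwdDiff u)^[k] g y := by
  rw [kSymmDiff, if_pos ⟨by linarith, by linarith⟩, fwdDiff_iterate_eq_sum,
    ← Finset.sum_range_reflect]
  refine Finset.sum_congr rfl fun i hi => ?_
  have hik : i ≤ k := Nat.lt_succ_iff.1 (Finset.mem_range.1 hi)
  rw [Nat.add_sub_cancel, Nat.choose_symm hik, Nat.cast_sub hik]
  congr 2
  ring

theorem smoothOmega_nonneg (k : ℕ) (g : ℝ → ℝ) (t a b : ℝ) : 0 ≤ smoothOmega k g t a b :=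
  Real.sSup_nonneg fun _ ⟨_, _, _, _, hv⟩ => hv ▸ abs_nonneg _

theorem kSymmDiff_abs_le_smoothOmega {k : ℕ} {g : ℝ → ℝ} {a b : ℝ}
    (hg : ContinuousOn g (Set.Icc a b)) {u t : ℝ} (hu : 0 < u) (hut : u ≤ t) (x : ℝ) :
    |kSymmDiff k g u x a b| ≤ smoothOmega k g t a b := by
  refine le_csSup ?_ ⟨u, x, hu, hut, rfl⟩
  obtain ⟨M, hM⟩ := isCompact_Icc.exists_bound_of_continuousOn hg
  refine ⟨∑ i ∈ Finset.range (k + 1), (k.choose i) * |M|, ?_⟩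
  rintro _ ⟨u, x, hu, -, rfl⟩
  rw [kSymmDiff]
  split_ifs with h
  · refine (Finset.abs_sum_le_sum_abs _ _).trans (Finset.sum_le_sum fun i hi => ?_)
    have hik : (i : ℝ) ≤ k := by exact_mod_cast Nat.lt_succ_iff.1 (Finset.mem_range.1 hi)
    have h0 : (0 : ℝ) ≤ i := Nat.cast_nonneg i
    have h1 := hM (x + ((k : ℝ) / 2 - i) * u) ⟨by nlinarith [h.1], by nlinarith [h.2]⟩
    rw [abs_mul, abs_mul, abs_pow, abs_neg, abs_one, one_pow, one_mul, Nat.abs_cast]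
    exact mul_le_mul_of_nonneg_left (h1.trans (le_abs_self M)) (Nat.cast_nonneg _)
  · rw [abs_zero]; positivity

theorem smoothOmega_mono {k : ℕ} {g : ℝ → ℝ} {a b : ℝ} (hg : ContinuousOn g (Set.Icc a b))
    {s t : ℝ} (hst : s ≤ t) : smoothOmega k g s a b ≤ smoothOmega k g t a b := by
  refine Real.sSup_le ?_ (smoothOmega_nonneg _ _ _ _ _)
  rintro _ ⟨u, x, hu, hus, rfl⟩
  exact kSymmDiff_abs_le_smoothOmega hg hu (hus.trans hst) x

theorem Polynomial.fwdDiff_iterate_eq_zero {P : Polynomial ℝ} {k : ℕ} (hP : P.natDegree < k)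
    (u x : ℝ) : (fwdDiff u)^[k] (fun y => P.eval y) x = 0 := by
  set R : Polynomial ℝ := P.comp (Polynomial.C x + Polynomial.C u * Polynomial.X) with hR
  have hRd : R.natDegree < k := by
    have h1 : (Polynomial.C x + Polynomial.C u * Polynomial.X : Polynomial ℝ).natDegree ≤ 1 := by
      compute_degree
    have h2 := Polynomial.natDegree_comp_le (p := P)
      (q := (Polynomial.C x + Polynomial.C u * Polynomial.X : Polynomial ℝ))
    have h3 := Nat.mul_le_mul_left P.natDegree h1
    rw [← hR] at h2
    omega
  have h := congrFun (Polynomial.fwdDiff_iter_eq_zero_of_degree_lt hRd) 0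
  rw [fwdDiff_iterate_eq_sum, Pi.zero_apply] at h
  rw [fwdDiff_iterate_eq_sum, ← h]
  refine Finset.sum_congr rfl fun i _ => ?_
  rw [hR, Polynomial.eval_comp]
  simp only [Polynomial.eval_add, Polynomial.eval_mul, Polynomial.eval_C, Polynomial.eval_X]
  ring_nf

/-- The `k`-th difference of an affinely rescaled function, up to a polynomial of small degree. -/
theorem fwdDiff_iterate_rescale {P : Polynomial ℝ} {k : ℕ} (hP : P.natDegree < k) (g : ℝ → ℝ)
    (q a h u x : ℝ) :
    (fwdDiff u)^[k] (fun y => q * (g (a + h * y) - P.eval (a + h * y))) x =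
      q * (fwdDiff (h * u))^[k] g (a + h * x) := by
  have h0 := P.fwdDiff_iterate_eq_zero hP (h * u) (a + h * x)
  rw [← sub_zero ((fwdDiff (h * u))^[k] g (a + h * x)), ← h0]
  simp only [fwdDiff_iterate_eq_sum]
  rw [← Finset.sum_sub_distrib, Finset.mul_sum]
  refine Finset.sum_congr rfl fun i _ => ?_
  rw [show a + h * (x + i * u) = a + h * x + i * (h * u) by ring]
  ring

theorem add_gap_le_of_lt {z : ℕ → ℝ} {μ : ℕ} {ρ : ℝ} (hρ : 0 ≤ ρ)
    (hz : ∀ j, j + 1 ≤ μ → ρ ≤ z (j + 1) - z j) {i j : ℕ} (hij : i < j) (hj : j ≤ μ) :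
    z i + ρ ≤ z j := by
  induction j, hij using Nat.le_induction with
  | base => linarith [hz i hj]
  | succ j _ ih => linarith [ih (by omega), hz j hj]

/-- bounded form of the pointwise estimate for Hermite
interpolation with full multiplicity `r+1` at separated knots. -/
theorem stmt19 (r μ : ℕ) (hμ : 1 ≤ μ) (lam : ℝ) (hlam0 : 0 < lam) (hlam1 : lam ≤ 1) :
    ∃ C : ℝ, 0 < C ∧ ∀ z : ℕ → ℝ,
      (∀ j : ℕ, j + 1 ≤ μ → z j < z (j + 1)) →
      (∀ j : ℕ, j + 1 ≤ μ → lam * (z μ - z 0) ≤ z (j + 1) - z j) →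
      ∀ f : ℝ → ℝ, ContDiffOn ℝ r f (Set.Icc (z 0) (z μ)) →
      ∀ L : Polynomial ℝ, L.natDegree ≤ (r + 1) * (μ + 1) - 1 →
      (∀ ν : ℕ, ν ≤ μ → ∀ j : ℕ, j ≤ r →
        (Polynomial.derivative^[j] L).eval (z ν) =
          iteratedDerivWithin j f (Set.Icc (z 0) (z μ)) (z ν)) →
      ∀ t ∈ Set.Icc (z 0) (z μ),
        |f t - L.eval t| ≤
          C * (sInf {v : ℝ | ∃ ν : ℕ, ν ≤ μ ∧ v = |t - z ν|}) ^ r *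
            smoothOmega ((r + 1) * (μ + 1) - r)
              (iteratedDerivWithin r f (Set.Icc (z 0) (z μ)))
              ((z μ - z 0) *
                ((sInf {v : ℝ | ∃ ν : ℕ, ν ≤ μ ∧ v = |t - z ν|}) / (z μ - z 0)) ^
                  ((1 : ℝ) / (((r + 1) * (μ + 1) - r : ℕ) : ℝ)))
              (z 0) (z μ) ∧
        C * (sInf {v : ℝ | ∃ ν : ℕ, ν ≤ μ ∧ v = |t - z ν|}) ^ r *
            smoothOmega ((r + 1) * (μ + 1) - r)
              (iteratedDerivWithin r f (Set.Icc (z 0) (z μ)))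
              ((z μ - z 0) *
                ((sInf {v : ℝ | ∃ ν : ℕ, ν ≤ μ ∧ v = |t - z ν|}) / (z μ - z 0)) ^
                  ((1 : ℝ) / (((r + 1) * (μ + 1) - r : ℕ) : ℝ)))
              (z 0) (z μ) ≤
          C * (sInf {v : ℝ | ∃ ν : ℕ, ν ≤ μ ∧ v = |t - z ν|}) ^ r *
            smoothOmega ((r + 1) * (μ + 1) - r)
              (iteratedDerivWithin r f (Set.Icc (z 0) (z μ))) (z μ - z 0) (z 0) (z μ) := by
  obtain ⟨C, hC, hmain⟩ := exists_vanishing_bound r μ hlam0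
  refine ⟨C, hC, fun z hz hsep f hf L hL hLf t ht => ?_⟩
  have hkeq : (r + 1) * (μ + 1) - r = (r + 1) * μ + 1 := by
    rw [Nat.sub_eq_iff_eq_add (by nlinarith)]; ring
  rw [hkeq]
  set k := (r + 1) * μ + 1 with hk
  set h := z μ - z 0 with hh
  set I := Set.Icc (z 0) (z μ) with hI
  set d := sInf {v : ℝ | ∃ ν : ℕ, ν ≤ μ ∧ v = |t - z ν|} with hd
  have hh0 : 0 < h := by
    have h1 := add_gap_le_of_lt le_rfl (fun j hj => (sub_pos.2 (hz j hj)).le) (i := 0) hμ le_rfl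
    rcases hμ.eq_or_lt with h2 | h2
    · have := hz 0 h2.le
      rw [zero_add, h2] at this
      exact sub_pos.2 this
    · have h3 := add_gap_le_of_lt le_rfl (fun j hj => (sub_pos.2 (hz j hj)).le) h2 le_rfl
      have h4 := hz 0 hμ
      rw [zero_add] at h4
      linarith
  have hgap : ∀ i j, i < j → j ≤ μ → z i + lam * h ≤ z j := fun i j =>
    add_gap_le_of_lt (by positivity) hsep
  have hlh : 0 < lam * h := by positivity
  have hzI : ∀ ν, ν ≤ μ → z ν ∈ I := by
    refine fun ν hν => ⟨?_, ?_⟩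
    · rcases (Nat.zero_le ν).eq_or_lt with h1 | h1
      · rw [← h1]
      · linarith [hgap 0 ν h1 hν]
    · rcases hν.eq_or_lt with h1 | h1
      · rw [h1]
      · linarith [hgap ν μ h1 le_rfl]
  obtain ⟨ν, hν, hdν⟩ : d ∈ {v : ℝ | ∃ ν : ℕ, ν ≤ μ ∧ v = |t - z ν|} := by
    refine Set.Nonempty.csInf_mem ⟨_, 0, Nat.zero_le _, rfl⟩ ?_
    refine ((Set.finite_Iic μ).image fun ν => |t - z ν|).subset ?_
    rintro _ ⟨ν, hν, rfl⟩
    exact ⟨ν, hν, rfl⟩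
  have hd0 : 0 ≤ d := hdν ▸ abs_nonneg _
  have hdh : d ≤ h := by
    rw [hdν, abs_le]
    constructor <;> linarith [ht.1, ht.2, (hzI ν hν).1, (hzI ν hν).2]
  have hk0 : (0 : ℝ) < (k : ℕ) := by positivity
  set σ : ℝ := (d / h) ^ ((1 : ℝ) / (k : ℝ)) with hσ
  have hdh0 : 0 ≤ d / h := by positivity
  have hσ0 : 0 ≤ σ := Real.rpow_nonneg hdh0 _
  have hσ1 : σ ≤ 1 := Real.rpow_le_one hdh0 ((div_le_one hh0).2 hdh) (by positivity)
  have hσk : σ ^ k = d / h := by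
    rw [hσ, one_div, Real.rpow_inv_natCast_pow hdh0 (by omega)]
  have huniq : UniqueDiffOn ℝ I := uniqueDiffOn_Icc (sub_pos.1 hh0)
  have hcont : ContinuousOn (iteratedDerivWithin r f I) I :=
    hf.continuousOn_iteratedDerivWithin le_rfl huniq
  refine ⟨?_, mul_le_mul_of_nonneg_left (smoothOmega_mono hcont ?_) (by positivity)⟩
  swap
  · exact mul_le_of_le_one_right hh0.le hσ1
  have hω0 := smoothOmega_nonneg k (iteratedDerivWithin r f I) (h * σ) (z 0) (z μ)
  rcases hd0.eq_or_lt with hd0' | hd0'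
  · rw [← hd0', eq_comm, abs_eq_zero, sub_eq_zero] at hdν
    have := hLf ν hν 0 (Nat.zero_le r)
    rw [Function.iterate_zero, id, iteratedDerivWithin_zero, ← hdν] at this
    rw [this, sub_self, abs_zero]
    positivity
  have hmaps : ∀ x ∈ Set.Icc (0 : ℝ) 1, z 0 + h * x ∈ I := fun x hx =>
    ⟨by nlinarith [hx.1], by nlinarith [hx.2]⟩
  have hinv : ∀ y, z 0 + h * ((y - z 0) / h) = y := fun y => by field_simp; ring
  have hinvI : ∀ y ∈ I, (y - z 0) / h ∈ Set.Icc (0 : ℝ) 1 := fun y hy =>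
    ⟨div_nonneg (by linarith [hy.1]) hh0.le, (div_le_one hh0).2 (by linarith [hy.2])⟩
  have hdist : ∀ x y, |(x - z 0) / h - (y - z 0) / h| = |x - y| / h := fun x y => by
    rw [← sub_div, abs_div, abs_of_pos hh0, sub_sub_sub_cancel_right]
  have key := hmain (fun i => (z i - z 0) / h)
    (fun i => hinvI _ (hzI i (Nat.lt_succ_iff.1 i.2)))
    (fun i j hij => by
      rw [hdist, le_div_iff₀ hh0]
      rcases lt_or_gt_of_ne (Fin.val_ne_of_ne hij) with h1 | h1
      · have := hgap i j h1 (Nat.lt_succ_iff.1 j.2)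
        rw [abs_sub_comm]
        exact le_abs.2 (Or.inl (by linarith))
      · have := hgap j i h1 (Nat.lt_succ_iff.1 i.2)
        exact le_abs.2 (Or.inl (by linarith)))
    (fun j x => h ^ j * (iteratedDerivWithin j f I (z 0 + h * x) -
      (Polynomial.derivative^[j] L).eval (z 0 + h * x)))
    (fun j hj x hx => by
      have h1 : HasDerivWithinAt (iteratedDerivWithin j f I)
          (iteratedDerivWithin (j + 1) f I (z 0 + h * x)) I (z 0 + h * x) := by
        rw [iteratedDerivWithin_succ]
        exact (hf.differentiableOn_iteratedDerivWithin (by exact_mod_cast hj) huniq _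
          (hmaps x hx)).hasDerivWithinAt
      have h2 := (Polynomial.derivative^[j] L).hasDerivAt (z 0 + h * x)
      rw [← Function.iterate_succ_apply' (f := Polynomial.derivative)] at h2
      have h3 : HasDerivWithinAt (fun y : ℝ => z 0 + h * y) h (Set.Icc 0 1) x := by
        simpa using (((hasDerivAt_id x).const_mul h).const_add (z 0)).hasDerivWithinAt
      have h4 := ((h1.sub h2.hasDerivWithinAt).scomp x h3 hmaps).const_mul (h ^ j)
      refine h4.congr_deriv ?_
      simp only [smul_eq_mul]
      ring)
    (by
      refine continuousOn_const.mul (ContinuousOn.sub ?_ (by fun_prop))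
      exact hcont.comp (by fun_prop) hmaps)
    (fun i j hj => by
      rw [hinv, hLf i (Nat.lt_succ_iff.1 i.2) j hj, sub_self, mul_zero])
    σ (Real.rpow_pos_of_pos (by positivity) _) hσ1
    (h ^ r * smoothOmega k (iteratedDerivWithin r f I) (h * σ) (z 0) (z μ)) (by positivity)
    (fun u x hu hus hx hxu => by
      rw [fwdDiff_iterate_rescale, abs_mul, abs_of_pos (by positivity : 0 < h ^ r)]
      · refine mul_le_mul_of_nonneg_left ?_ (by positivity)
        rw [← kSymmDiff_eq_fwdDiff (a := z 0) (b := z μ) (by nlinarith) (by nlinarith)]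
        exact kSymmDiff_abs_le_smoothOmega hcont (by positivity)
          (mul_le_mul_of_nonneg_left hus hh0.le) _
      · have h1 := Polynomial.natDegree_iterate_derivative L r
        omega)
    ⟨ν, Nat.lt_succ_iff.2 hν⟩ ((t - z 0) / h) (hinvI t ht) (by
      rw [hdist, hσk, hdν])
  beta_reduce at key
  rw [hinv, hσk] at key
  simp only [pow_zero, one_mul, iteratedDerivWithin_zero, Function.iterate_zero, id] at key
  refine key.trans (le_of_eq ?_)
  rw [div_pow]
  field_simp
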